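/- Let p ∈ [0,1]^n be a point with finite denominator d = den(p). Then the orbit of p under the monoid of McNaughton mappings of [0,1]^n is exactly the set {q ∈ [0,1]^n : q has finite denominator and den(q) divides d}; in particular this orbit is finite. -/

import Mathlib

/-- The unit cube `[0,1]^n` inside `Fin n → ℝ`. -/
def unitCube (n : ℕ) : Set (Fin n → ℝ) := Set.univ.pi fun _ => Set.Icc (0:ℝ) 1

/-- A McNaughton function in `n` variables: a continuous function
`[0,1]^n → [0,1]` which, at every point of the cube, agrees with one of
finitely many affine polynomials with integer coefficients. -/
def IsMcNaughtonFn {n : ℕ} (f : (Fin n → ℝ) → ℝ) : Prop :=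
  ContinuousOn f (unitCube n) ∧
  Set.MapsTo f (unitCube n) (Set.Icc (0:ℝ) 1) ∧
  ∃ (m : ℕ) (a : Fin m → Fin n → ℤ) (b : Fin m → ℤ),
    ∀ x ∈ unitCube n, ∃ j : Fin m,
      f x = (∑ i : Fin n, (a j i : ℝ) * x i) + (b j : ℝ)

/-- A McNaughton mapping of `[0,1]^n`: each coordinate is a McNaughton
function. -/
def IsMcNaughtonMap {n : ℕ} (S : (Fin n → ℝ) → (Fin n → ℝ)) : Prop :=
  ∀ i : Fin n, IsMcNaughtonFn (fun x => S x i)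

/-- A McNaughton homeomorphism of `[0,1]^n`: a McNaughton mapping which is a
bijection of the cube onto itself whose inverse is also a McNaughton mapping. -/
def IsMcNaughtonHomeo {n : ℕ} (S : (Fin n → ℝ) → (Fin n → ℝ)) : Prop :=
  IsMcNaughtonMap S ∧ ∃ T : (Fin n → ℝ) → (Fin n → ℝ), IsMcNaughtonMap T ∧
    (∀ x ∈ unitCube n, T (S x) = x) ∧ (∀ x ∈ unitCube n, S (T x) = x)

/-- `p ∈ [0,1]^n` has `d` as a denominator: `d > 0` and `d • p ∈ ℤ^n`. -/
def IsDenom {n : ℕ} (p : Fin n → ℝ) (d : ℕ) : Prop :=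
  0 < d ∧ ∀ i : Fin n, ∃ z : ℤ, (d : ℝ) * p i = (z : ℝ)

/-- The denominator of a point: the least positive integer `d` with
`d • p ∈ ℤ^n` (junk value `0` if there is none). -/
noncomputable def den {n : ℕ} (p : Fin n → ℝ) : ℕ := sInf {d | IsDenom p d}

theorem isDenom_den {n : ℕ} {p : Fin n → ℝ} (h : ∃ d, IsDenom p d) : IsDenom p (den p) :=
  Nat.sInf_mem h

theorem den_dvd_of_isDenom {n : ℕ} {p : Fin n → ℝ} {d : ℕ} (h : IsDenom p d) : den p ∣ d := by
  have hden := isDenom_den ⟨d, h⟩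
  rw [Nat.dvd_iff_mod_eq_zero]
  by_contra hne
  have hmod : IsDenom p (d % den p) := by
    refine ⟨Nat.pos_of_ne_zero hne, fun i => ?_⟩
    obtain ⟨z, hz⟩ := h.2 i
    obtain ⟨w, hw⟩ := hden.2 i
    refine ⟨z - (d / den p : ℕ) * w, ?_⟩
    have hdiv : ((d % den p : ℕ) : ℝ) + (den p : ℝ) * ((d / den p : ℕ) : ℝ) = d := by
      exact_mod_cast Nat.mod_add_div d (den p)
    simp only [Int.cast_sub, Int.cast_mul, Int.cast_natCast]
    linear_combination (p i) * hdiv + hz - ((d / den p : ℕ) : ℝ) * hw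
  exact absurd (Nat.sInf_le hmod : den p ≤ _) (not_le.mpr (Nat.mod_lt _ hden.1))

theorem IsDenom.of_dvd {n : ℕ} {p : Fin n → ℝ} {c d : ℕ} (h : IsDenom p c) (hcd : c ∣ d)
    (hd : 0 < d) : IsDenom p d := by
  refine ⟨hd, fun i => ?_⟩
  obtain ⟨k, rfl⟩ := hcd
  obtain ⟨z, hz⟩ := h.2 i
  refine ⟨k * z, ?_⟩
  push_cast
  rw [← hz]
  ring

/-- A point of finite denominator, scaled to an integer vector by its denominator `d`, together
with `d` generates the unit ideal of `ℤ`. -/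
theorem exists_affine_eq_inv_den {n : ℕ} {p : Fin n → ℝ} (h : ∃ d, IsDenom p d) :
    ∃ (a : Fin n → ℤ) (b : ℤ), (den p : ℝ) * ((∑ i, (a i : ℝ) * p i) + b) = 1 := by
  have hden := isDenom_den h
  choose z hz using hden.2
  let v : Option (Fin n) → ℤ := fun o => o.elim (den p : ℤ) z
  obtain ⟨g, hg⟩ := (IsPrincipalIdealRing.principal (Ideal.span (Set.range v))).principal
  have hdvd : ∀ o, g ∣ v o := fun o => by
    have hmem : v o ∈ Ideal.span (Set.range v) := Ideal.subset_span ⟨o, rfl⟩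
    rw [hg] at hmem
    exact Ideal.mem_span_singleton.mp hmem
  obtain ⟨e, he⟩ : g ∣ (den p : ℤ) := hdvd none
  have hne : g * e ≠ 0 := by
    rw [← he]
    exact_mod_cast hden.1.ne'
  have hg0 : g ≠ 0 := left_ne_zero_of_mul hne
  have he0 : e ≠ 0 := right_ne_zero_of_mul hne
  have hdenom : IsDenom p e.natAbs := by
    refine ⟨Int.natAbs_pos.mpr he0, fun i => ?_⟩
    obtain ⟨w, hw⟩ : g ∣ z i := hdvd (some i)
    have hew : (e : ℝ) * p i = w := by
      have hgR : (g : ℝ) ≠ 0 := by exact_mod_cast hg0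
      apply mul_left_cancel₀ hgR
      have heR : (den p : ℝ) = g * e := by exact_mod_cast he
      have hwR : (z i : ℝ) = g * w := by exact_mod_cast hw
      rw [← hwR, ← hz i, heR, mul_assoc]
    rcases Int.natAbs_eq e with habs | habs
    · refine ⟨w, ?_⟩
      rw [← hew, ← Int.cast_natCast, ← habs]
    · refine ⟨-w, ?_⟩
      rw [Int.cast_neg, ← hew, ← Int.cast_natCast, ← neg_mul, ← Int.cast_neg]
      congr 2
      omega
  have hunit : IsUnit g := by
    have hle : den p ≤ e.natAbs := Nat.sInf_le hdenom
    have habs : den p = g.natAbs * e.natAbs := by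
      rw [← Int.natAbs_mul, ← he, Int.natAbs_natCast]
    rw [Int.isUnit_iff_natAbs_eq]
    have hgpos := Int.natAbs_pos.mpr hg0
    have hepos := Int.natAbs_pos.mpr he0
    nlinarith
  have hone : (1 : ℤ) ∈ Ideal.span (Set.range v) := by
    rw [hg]
    exact Ideal.mem_span_singleton.mpr hunit.dvd
  obtain ⟨c, hc⟩ := Ideal.mem_span_range_iff_exists_fun.mp hone
  refine ⟨fun i => c (some i), c none, ?_⟩
  rw [Fintype.sum_option] at hc
  have hcR : (c none : ℝ) * den p + ∑ i, (c (some i) : ℝ) * z i = 1 := by exact_mod_cast hc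
  rw [← hcR, mul_add, Finset.mul_sum, add_comm, mul_comm]
  congr 1
  refine Finset.sum_congr rfl fun i _ => ?_
  rw [← hz i]
  ring

/-- The truncation to `[0,1]` of an affine polynomial with integer coefficients is a McNaughton
function. -/
theorem isMcNaughtonFn_truncate {n : ℕ} (a : Fin n → ℤ) (b : ℤ) :
    IsMcNaughtonFn fun x : Fin n → ℝ => max 0 (min 1 ((∑ i, (a i : ℝ) * x i) + b)) := by
  refine ⟨by fun_prop, fun x _ => ⟨le_max_left _ _, max_le zero_le_one (min_le_left _ _)⟩,
    3, ![0, 0, a], ![0, 1, b], fun x _ => ?_⟩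
  rcases max_choice 0 (min 1 ((∑ i, (a i : ℝ) * x i) + b)) with h | h
  · exact ⟨0, by simp [h]⟩
  · rcases min_choice 1 ((∑ i, (a i : ℝ) * x i) + (b : ℝ)) with h' | h'
    · exact ⟨1, by simp [h']⟩
    · exact ⟨2, by simpa [h'] using h⟩

theorem exists_isMcNaughtonFn_eq {n : ℕ} {p : Fin n → ℝ} (h : ∃ d, IsDenom p d) {t : ℝ}
    (ht : t ∈ Set.Icc (0 : ℝ) 1) {k : ℤ} (hk : (den p : ℝ) * t = k) :
    ∃ f : (Fin n → ℝ) → ℝ, IsMcNaughtonFn f ∧ f p = t := by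
  obtain ⟨a, b, hab⟩ := exists_affine_eq_inv_den h
  refine ⟨_, isMcNaughtonFn_truncate (fun i => k * a i) (k * b), ?_⟩
  have hval : (∑ i, ((k * a i : ℤ) : ℝ) * p i) + ((k * b : ℤ) : ℝ) = t := by
    simp only [Int.cast_mul, mul_assoc]
    rw [← Finset.mul_sum, ← mul_add, ← hk]
    linear_combination t * hab
  simp only [hval, min_eq_right ht.2, max_eq_right ht.1]

theorem IsMcNaughtonMap.isDenom_apply {n : ℕ} {S : (Fin n → ℝ) → (Fin n → ℝ)}
    (hS : IsMcNaughtonMap S) {p : Fin n → ℝ} (hp : p ∈ unitCube n) {d : ℕ} (hd : IsDenom p d) :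
    IsDenom (S p) d := by
  refine ⟨hd.1, fun i => ?_⟩
  obtain ⟨-, -, m, a, b, hab⟩ := hS i
  obtain ⟨j, hj⟩ := hab p hp
  choose z hz using hd.2
  refine ⟨(∑ l, a j l * z l) + d * b j, ?_⟩
  push_cast
  rw [show S p i = _ from hj, mul_add, Finset.mul_sum]
  congr 1
  refine Finset.sum_congr rfl fun l _ => ?_
  rw [← hz l]
  ring

theorem finite_unitCube_inter_isDenom (n d : ℕ) :
    {q : Fin n → ℝ | q ∈ unitCube n ∧ IsDenom q d}.Finite := by
  refine (Set.Finite.pi' fun _ : Fin n =>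
    (Set.finite_Icc (0 : ℤ) d).image fun k : ℤ => (k : ℝ) / d).subset ?_
  rintro q ⟨hq, hd, hz⟩ i
  obtain ⟨z, hz⟩ := hz i
  have hdR : (0 : ℝ) < d := by exact_mod_cast hd
  have hqi : q i ∈ Set.Icc (0 : ℝ) 1 := hq i trivial
  refine ⟨z, ⟨?_, ?_⟩, ?_⟩
  · have : (0 : ℝ) ≤ z := hz ▸ mul_nonneg hdR.le hqi.1
    exact_mod_cast this
  · have : (z : ℝ) ≤ d := hz ▸ mul_le_of_le_one_right hdR.le hqi.2
    exact_mod_cast this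
  · change (z : ℝ) / d = q i
    rw [div_eq_iff hdR.ne', ← hz, mul_comm]

/-- The orbit of a finite-denominator point `p` under McNaughton mappings is
exactly the set of points of the cube whose denominator divides `den p`; in
particular the orbit is finite. -/
theorem mcnaughton_orbit_of_finite_den {n : ℕ} (p : Fin n → ℝ)
    (hp : p ∈ unitCube n) (hfin : ∃ d, IsDenom p d) :
    {q | ∃ S : (Fin n → ℝ) → (Fin n → ℝ), IsMcNaughtonMap S ∧ S p = q} =
      {q | q ∈ unitCube n ∧ (∃ d, IsDenom q d) ∧ den q ∣ den p} ∧
    Set.Finite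
      {q | ∃ S : (Fin n → ℝ) → (Fin n → ℝ), IsMcNaughtonMap S ∧ S p = q} := by
  have hden := isDenom_den hfin
  have horbit : {q | ∃ S : (Fin n → ℝ) → (Fin n → ℝ), IsMcNaughtonMap S ∧ S p = q} =
      {q | q ∈ unitCube n ∧ (∃ d, IsDenom q d) ∧ den q ∣ den p} := by
    ext q
    constructor
    · rintro ⟨S, hS, rfl⟩
      have hSp := hS.isDenom_apply hp hden
      exact ⟨fun i _ => (hS i).2.1 hp, ⟨_, hSp⟩, den_dvd_of_isDenom hSp⟩
    · rintro ⟨hq, hqfin, hdvd⟩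
      have hqd := (isDenom_den hqfin).of_dvd hdvd hden.1
      choose z hz using hqd.2
      choose f hf hfp using fun i => exists_isMcNaughtonFn_eq hfin (hq i trivial) (hz i)
      exact ⟨fun x i => f i x, hf, funext hfp⟩
  refine ⟨horbit, horbit ▸ (finite_unitCube_inter_isDenom n (den p)).subset ?_⟩
  rintro q ⟨hq, hqfin, hdvd⟩
  exact ⟨hq, (isDenom_den hqfin).of_dvd hdvd hden.1⟩
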